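/- Let p ∈ [1,∞) and let f ∈ L¹_loc(μ) be such that ∫_X f dμ = 0 when μ(X) < ∞. If for every R > 0 one has sup_{ℓ∈(0,R)} ℓ^p μ({x ∈ X : N(f)(x) > ℓ}) < ∞, then there exists a constant C > 0, independent of f, such that sup_{ℓ∈(0,∞)} ℓ^p μ({x ∈ X : N(f)(x) > ℓ}) ≤ C sup_{ℓ∈(0,∞)} ℓ^p μ({x ∈ X : M♯(f)(x) > ℓ}). -/

import Mathlib

open MeasureTheory Metric Set
open scoped ENNReal NNReal

namespace NonHomog

variable {X : Type*} [MetricSpace X] [MeasurableSpace X] [BorelSpace X]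

/-- `(X, d, μ)` is upper doubling with dominating function `lam` and constant `Clam`,
also satisfying `lam x r ≤ Clam * lam y r` whenever `dist x y ≤ r`. -/
structure IsUpperDoubling (μ : Measure X) (lam : X → ℝ → ℝ) (Clam : ℝ) : Prop where
  one_lt : 1 < Clam
  lam_pos : ∀ x r, 0 < r → 0 < lam x r
  lam_mono : ∀ x r s, 0 < r → r ≤ s → lam x r ≤ lam x s
  measure_ball_le : ∀ x r, 0 < r → μ (ball x r) ≤ ENNReal.ofReal (lam x r)
  lam_le : ∀ x r, 0 < r → lam x r ≤ Clam * lam x (r / 2)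
  lam_comp : ∀ x y r, 0 < r → dist x y ≤ r → lam x r ≤ Clam * lam y r

/-- `(X, d)` is geometrically doubling with constant `N0`. -/
def GeometricallyDoubling (X : Type*) [MetricSpace X] (N0 : ℕ) : Prop :=
  ∀ (x : X) (r : ℝ), 0 < r → ∃ s : Finset X, s.card ≤ N0 ∧
    ball x r ⊆ ⋃ y ∈ s, ball y (r / 2)

/-- The size condition for the kernel `K`. -/
def KernelSize (lam : X → ℝ → ℝ) (K : X → X → ℝ) (CK : ℝ) : Prop :=
  ∀ x y : X, x ≠ y → |K x y| ≤ CK * dist x y / lam x (dist x y)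

/-- The regularity (Hörmander-type) condition for the kernel `K`. -/
def KernelReg (μ : Measure X) (K : X → X → ℝ) (CK : ℝ) : Prop :=
  ∀ y y' : X,
    ∫⁻ x in {x : X | 2 * dist y y' ≤ dist x y},
      ENNReal.ofReal ((|K x y - K x y'| + |K y x - K y' x|) / dist x y) ∂μ
      ≤ ENNReal.ofReal CK

/-- The Marcinkiewicz integral associated with the kernel `K`. -/
noncomputable def marcinkiewicz (μ : Measure X) (K : X → X → ℝ) (f : X → ℝ) (x : X) : ℝ≥0∞ :=
  (∫⁻ t in Ioi (0 : ℝ),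
      (ENNReal.ofReal |∫ y in {y : X | dist x y < t}, K x y * f y ∂μ|) ^ 2
        / ENNReal.ofReal (t ^ 3)) ^ (1 / 2 : ℝ)

/-- The coefficient `δ(B, S)` for balls `B = B(cB, rB) ⊆ S = B(cS, rS)`. -/
noncomputable def delta (μ : Measure X) (lam : X → ℝ → ℝ)
    (cB : X) (rB : ℝ) (cS : X) (rS : ℝ) : ℝ :=
  ∫ x in ball cS (2 * rS) \ ball cB rB, 1 / lam cB (dist x cB) ∂μ

/-- The exponent `1/p - 1` (interpreted as `-1` when `p = ∞`). -/
noncomputable def atomExp (p : ℝ≥0∞) : ℝ := 1 / p.toReal - 1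

/-- `b` is a `(p,1)_λ`-atomic block with `|b|_{H^{1,p}_atb} = ν`. -/
def IsAtomicBlock (μ : Measure X) (lam : X → ℝ → ℝ) (ρ : ℝ) (p : ℝ≥0∞)
    (b : X → ℝ) (ν : ℝ) : Prop :=
  ∃ (cB : X) (rB : ℝ), 0 < rB ∧ Function.support b ⊆ ball cB rB ∧
    Integrable b μ ∧ (∫ x, b x ∂μ) = 0 ∧
    ∃ (κ₁ κ₂ : ℝ) (a₁ a₂ : X → ℝ) (c₁ c₂ : X) (r₁ r₂ : ℝ),
      0 < r₁ ∧ 0 < r₂ ∧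
      ball c₁ r₁ ⊆ ball cB rB ∧ ball c₂ r₂ ⊆ ball cB rB ∧
      Function.support a₁ ⊆ ball c₁ r₁ ∧ Function.support a₂ ⊆ ball c₂ r₂ ∧
      (∀ x, b x = κ₁ * a₁ x + κ₂ * a₂ x) ∧
      eLpNorm a₁ p μ ≤ μ (ball c₁ (ρ * r₁)) ^ atomExp p *
        ENNReal.ofReal ((1 + delta μ lam c₁ r₁ cB rB)⁻¹) ∧
      eLpNorm a₂ p μ ≤ μ (ball c₂ (ρ * r₂)) ^ atomExp p *
        ENNReal.ofReal ((1 + delta μ lam c₂ r₂ cB rB)⁻¹) ∧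
      ν = |κ₁| + |κ₂|

/-- A building block of `H¹(μ)` : either a `(p,1)_λ`-atomic block, or
(when `μ(X) < ∞`) the constant function `μ(X)⁻¹`, regarded as an atomic
block of norm `1`. -/
def IsH1Block (μ : Measure X) (lam : X → ℝ → ℝ) (ρ : ℝ) (p : ℝ≥0∞)
    (b : X → ℝ) (ν : ℝ) : Prop :=
  IsAtomicBlock μ lam ρ p b ν ∨
    (μ Set.univ ≠ ∞ ∧ (∀ x, b x = ((μ Set.univ).toReal)⁻¹) ∧ ν = 1)

/-- Membership in the atomic Hardy space `H¹(μ)` (with `ρ = 2`, `p = ∞`;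
the space is independent of these choices). -/
def MemH1 (μ : Measure X) (lam : X → ℝ → ℝ) (f : X → ℝ) : Prop :=
  Integrable f μ ∧ ∃ (b : ℕ → X → ℝ) (ν : ℕ → ℝ),
    (∀ j, IsH1Block μ lam 2 ⊤ (b j) (ν j)) ∧ Summable ν ∧
    ∀ᵐ x ∂μ, HasSum (fun j => b j x) (f x)

/-- The norm of `f` in the atomic Hardy space `H¹(μ)`. -/
noncomputable def H1norm (μ : Measure X) (lam : X → ℝ → ℝ) (f : X → ℝ) : ℝ :=
  sInf { s : ℝ | ∃ (b : ℕ → X → ℝ) (ν : ℕ → ℝ),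
    (∀ j, IsH1Block μ lam 2 ⊤ (b j) (ν j)) ∧ Summable ν ∧
    (∀ᵐ x ∂μ, HasSum (fun j => b j x) (f x)) ∧ s = ∑' j, ν j }

/-- `f` is a finite linear combination of `(p,1)_λ`-atomic blocks. -/
def MemH1fin (μ : Measure X) (lam : X → ℝ → ℝ) (ρ : ℝ) (p : ℝ≥0∞) (f : X → ℝ) : Prop :=
  ∃ (N : ℕ) (b : Fin N → X → ℝ) (ν : Fin N → ℝ),
    (∀ j, IsAtomicBlock μ lam ρ p (b j) (ν j)) ∧ ∀ x, f x = ∑ j, b j x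

/-- The norm in the finite atomic Hardy space `H^{1,p}_fin(μ)`. -/
noncomputable def H1finNorm (μ : Measure X) (lam : X → ℝ → ℝ) (ρ : ℝ) (p : ℝ≥0∞)
    (f : X → ℝ) : ℝ :=
  sInf { s : ℝ | ∃ (N : ℕ) (b : Fin N → X → ℝ) (ν : Fin N → ℝ),
    (∀ j, IsAtomicBlock μ lam ρ p (b j) (ν j)) ∧ (∀ x, f x = ∑ j, b j x) ∧
    s = ∑ j, ν j }

/-- `C` is an admissible `RBMO(μ)` constant for `f` (with `ρ = 2`). -/
def RBMOBound (μ : Measure X) (lam : X → ℝ → ℝ) (f : X → ℝ) (C : ℝ) : Prop :=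
  ∃ fB : X → ℝ → ℝ,
    (∀ (c : X) (r : ℝ), 0 < r →
      ∫ x in ball c r, |f x - fB c r| ∂μ ≤ C * (μ (ball c (2 * r))).toReal) ∧
    (∀ (cB : X) (rB : ℝ) (cS : X) (rS : ℝ), 0 < rB → 0 < rS →
      ball cB rB ⊆ ball cS rS →
      |fB cB rB - fB cS rS| ≤ C * (1 + delta μ lam cB rB cS rS))

/-- Membership in `RBMO(μ)`. -/
def MemRBMO (μ : Measure X) (lam : X → ℝ → ℝ) (f : X → ℝ) : Prop :=
  LocallyIntegrable f μ ∧ ∃ C : ℝ, 0 ≤ C ∧ RBMOBound μ lam f C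

/-- The `RBMO(μ)` norm. -/
noncomputable def RBMONorm (μ : Measure X) (lam : X → ℝ → ℝ) (f : X → ℝ) : ℝ :=
  sInf { C : ℝ | 0 ≤ C ∧ RBMOBound μ lam f C }

/-- The ball `B(c, r)` is `(α, β)`-doubling. -/
def IsDoublingBall (μ : Measure X) (α β : ℝ) (c : X) (r : ℝ) : Prop :=
  μ (ball c (α * r)) ≤ ENNReal.ofReal β * μ (ball c r)

/-- `β_α = α^{3 max(n,ν)} + 30^n + 30^ν` with `n = log₂ N₀`, `ν = log₂ C_λ`. -/
noncomputable def betaCoef (Clam : ℝ) (N0 : ℕ) (α : ℝ) : ℝ :=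
  α ^ (3 * max (Real.logb 2 (N0 : ℝ)) (Real.logb 2 Clam)) +
    (30 : ℝ) ^ (Real.logb 2 (N0 : ℝ)) + (30 : ℝ) ^ (Real.logb 2 Clam)

/-- `α^j B(c,r)` is the smallest `(α, β)`-doubling ball of the form `α^i B(c,r)`, `i ∈ ℕ`. -/
def IsSmallestDoubling (μ : Measure X) (α β : ℝ) (c : X) (r : ℝ) (j : ℕ) : Prop :=
  1 ≤ j ∧ IsDoublingBall μ α β c (α ^ j * r) ∧
    ∀ i : ℕ, 1 ≤ i → i < j → ¬ IsDoublingBall μ α β c (α ^ i * r)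

/-- The mean `m_B(f)` of `f` over the ball `B(c,r)`. -/
noncomputable def ballAvg (μ : Measure X) (f : X → ℝ) (c : X) (r : ℝ) : ℝ :=
  (∫ x in ball c r, f x ∂μ) / (μ (ball c r)).toReal

/-- `C` is an admissible `RBLO(μ)` constant for `f`, with parameters `η, ρ`. -/
def RBLOBound (μ : Measure X) (lam : X → ℝ → ℝ) (Clam : ℝ) (N0 : ℕ) (η ρ : ℝ)
    (f : X → ℝ) (C : ℝ) : Prop :=
  (∀ (c : X) (r : ℝ) (j : ℕ), 0 < r →
      IsSmallestDoubling μ ρ (betaCoef Clam N0 ρ) c r j →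
      ∫ x in ball c r, (f x - essInf f (μ.restrict (ball c (ρ ^ j * r)))) ∂μ ≤
        C * (μ (ball c (η * r))).toReal) ∧
  (∀ (cB : X) (rB : ℝ) (cS : X) (rS : ℝ), 0 < rB → 0 < rS →
      ball cB rB ⊆ ball cS rS →
      IsDoublingBall μ ρ (betaCoef Clam N0 ρ) cB rB →
      IsDoublingBall μ ρ (betaCoef Clam N0 ρ) cS rS →
      essInf f (μ.restrict (ball cB rB)) - essInf f (μ.restrict (ball cS rS)) ≤
        C * (1 + delta μ lam cB rB cS rS))

/-- Membership in `RBLO(μ)` (with `η = ρ = 2`; the space is independent of these choices). -/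
def MemRBLO (μ : Measure X) (lam : X → ℝ → ℝ) (Clam : ℝ) (N0 : ℕ) (f : X → ℝ) : Prop :=
  LocallyIntegrable f μ ∧ ∃ C : ℝ, 0 ≤ C ∧ RBLOBound μ lam Clam N0 2 2 f C

/-- The `RBLO(μ)` norm. -/
noncomputable def RBLONorm (μ : Measure X) (lam : X → ℝ → ℝ) (Clam : ℝ) (N0 : ℕ)
    (f : X → ℝ) : ℝ :=
  sInf { C : ℝ | 0 ≤ C ∧ RBLOBound μ lam Clam N0 2 2 f C }

/-- The non-centered doubling Hardy–Littlewood maximal function `N(f)`,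
taken over `(6, β)`-doubling balls. -/
noncomputable def maxN (μ : Measure X) (β : ℝ) (f : X → ℝ) (x : X) : ℝ≥0∞ :=
  ⨆ (c : X) (r : ℝ) (_ : 0 < r) (_ : x ∈ ball c r) (_ : IsDoublingBall μ 6 β c r),
    (∫⁻ y in ball c r, ENNReal.ofReal |f y| ∂μ) / μ (ball c r)

/-- The sharp maximal function `M♯(f)`. -/
noncomputable def sharpM (μ : Measure X) (lam : X → ℝ → ℝ) (Clam : ℝ) (N0 : ℕ)
    (f : X → ℝ) (x : X) : ℝ≥0∞ :=
  (⨆ (c : X) (r : ℝ) (j : ℕ) (_ : 0 < r) (_ : x ∈ ball c r)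
      (_ : IsSmallestDoubling μ 6 (betaCoef Clam N0 6) c r j),
    (∫⁻ y in ball c r, ENNReal.ofReal |f y - ballAvg μ f c (6 ^ j * r)| ∂μ) /
      μ (ball c (5 * r))) +
  ⨆ (cB : X) (rB : ℝ) (cS : X) (rS : ℝ) (_ : 0 < rB) (_ : 0 < rS)
      (_ : x ∈ ball cB rB) (_ : ball cB rB ⊆ ball cS rS)
      (_ : IsDoublingBall μ 6 (betaCoef Clam N0 6) cB rB)
      (_ : IsDoublingBall μ 6 (betaCoef Clam N0 6) cS rS),
    ENNReal.ofReal (|ballAvg μ f cB rB - ballAvg μ f cS rS| /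
      (1 + delta μ lam cB rB cS rS))

/-- The `L^p(μ)`-"norm" of an `ℝ≥0∞`-valued function. -/
noncomputable def lpNormE (μ : Measure X) (p : ℝ) (g : X → ℝ≥0∞) : ℝ≥0∞ :=
  (∫⁻ x, g x ^ p ∂μ) ^ (1 / p)

end NonHomog

namespace NonHomog

/-- `C1` is an admissible constant in the `RBLO(μ)` characterization of Lemma 2.3,
relative to `(ρ, β_ρ)`-doubling balls. -/
def RBLOChar {X : Type*} [MetricSpace X] [MeasurableSpace X]
    (μ : Measure X) (lam : X → ℝ → ℝ) (Clam : ℝ) (N0 : ℕ) (ρ : ℝ)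
    (f : X → ℝ) (C1 : ℝ) : Prop :=
  (∀ (c : X) (r : ℝ), 0 < r → IsDoublingBall μ ρ (betaCoef Clam N0 ρ) c r →
    ∫ x in ball c r, (f x - essInf f (μ.restrict (ball c r))) ∂μ ≤
      C1 * (μ (ball c r)).toReal) ∧
  (∀ (cB : X) (rB : ℝ) (cS : X) (rS : ℝ), 0 < rB → 0 < rS →
    ball cB rB ⊆ ball cS rS →
    IsDoublingBall μ ρ (betaCoef Clam N0 ρ) cB rB →
    IsDoublingBall μ ρ (betaCoef Clam N0 ρ) cS rS →
    ballAvg μ f cB rB - ballAvg μ f cS rS ≤ C1 * (1 + delta μ lam cB rB cS rS))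

end NonHomog
namespace NonHomog

section Helpers

open Filter Topology

variable {X : Type*} [MetricSpace X] [MeasurableSpace X]
  {μ : Measure X} {lam : X → ℝ → ℝ} {Clam : ℝ} {N0 : ℕ} {f : X → ℝ}

/-! ### Elementary consequences of upper doubling -/

lemma pow_six_le_betaCoef (hC : 1 < Clam) : Clam ^ 6 ≤ betaCoef Clam N0 6 := by
  have hν : 0 < Real.logb 2 Clam := Real.logb_pos (by norm_num) hC
  have h1 : Clam ^ 6 = (4 : ℝ) ^ (3 * Real.logb 2 Clam) := by
    rw [show (4 : ℝ) = 2 ^ (2 : ℝ) by norm_num, ← Real.rpow_mul (by norm_num),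
      show (2 : ℝ) * (3 * Real.logb 2 Clam) = Real.logb 2 Clam * (6 : ℕ) by push_cast; ring,
      Real.rpow_mul (by norm_num), Real.rpow_logb (by norm_num) (by norm_num) (by linarith),
      Real.rpow_natCast]
  have h2 : (4 : ℝ) ^ (3 * Real.logb 2 Clam) ≤ 6 ^ (3 * Real.logb 2 Clam) :=
    Real.rpow_le_rpow (by norm_num) (by norm_num) (by positivity)
  have h3 : (6 : ℝ) ^ (3 * Real.logb 2 Clam) ≤
      6 ^ (3 * max (Real.logb 2 (N0 : ℝ)) (Real.logb 2 Clam)) :=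
    Real.rpow_le_rpow_of_exponent_le (by norm_num)
      (mul_le_mul_of_nonneg_left (le_max_right _ _) (by norm_num))
  have h4 : 0 < (30 : ℝ) ^ (Real.logb 2 (N0 : ℝ)) := by positivity
  have h5 : 0 < (30 : ℝ) ^ (Real.logb 2 Clam) := by positivity
  unfold betaCoef
  linarith

lemma one_le_betaCoef (hC : 1 < Clam) : 1 ≤ betaCoef Clam N0 6 :=
  (one_le_pow₀ hC.le).trans (pow_six_le_betaCoef hC)

lemma IsUpperDoubling.lam_six_mul_le (hUD : IsUpperDoubling μ lam Clam) (x : X) {r : ℝ}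
    (hr : 0 < r) : lam x (6 * r) ≤ Clam ^ 3 * lam x r := by
  have hC : 0 < Clam := by linarith [hUD.one_lt]
  calc lam x (6 * r) ≤ lam x (8 * r) := hUD.lam_mono x _ _ (by linarith) (by linarith)
    _ ≤ Clam * lam x (4 * r) := by
      have := hUD.lam_le x (8 * r) (by linarith)
      rwa [show 8 * r / 2 = 4 * r by ring] at this
    _ ≤ Clam * (Clam * lam x (2 * r)) := by
      have := hUD.lam_le x (4 * r) (by linarith)
      rw [show 4 * r / 2 = 2 * r by ring] at this
      gcongr
    _ ≤ Clam * (Clam * (Clam * lam x r)) := by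
      have := hUD.lam_le x (2 * r) (by linarith)
      rw [show 2 * r / 2 = r by ring] at this
      gcongr
    _ = Clam ^ 3 * lam x r := by ring

lemma IsUpperDoubling.measure_ball_lt_top (hUD : IsUpperDoubling μ lam Clam) (x : X) (r : ℝ) :
    μ (ball x r) < ∞ := by
  rcases le_or_gt r 0 with hr | hr
  · simp [ball_eq_empty.2 hr]
  · exact (hUD.measure_ball_le x r hr).trans_lt ENNReal.ofReal_lt_top

/-- The density `μ(6^i B) / λ(c_B, 6^i r_B)`. -/
noncomputable def density (μ : Measure X) (lam : X → ℝ → ℝ) (c : X) (r : ℝ) (i : ℕ) : ℝ :=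
  (μ (ball c (6 ^ i * r))).toReal / lam c (6 ^ i * r)

lemma density_nonneg (hUD : IsUpperDoubling μ lam Clam) (c : X) {r : ℝ} (hr : 0 < r) (i : ℕ) :
    0 ≤ density μ lam c r i :=
  div_nonneg ENNReal.toReal_nonneg (hUD.lam_pos c _ (by positivity)).le

lemma density_le_one (hUD : IsUpperDoubling μ lam Clam) (c : X) {r : ℝ} (hr : 0 < r) (i : ℕ) :
    density μ lam c r i ≤ 1 := by
  have hpos : 0 < 6 ^ i * r := by positivity
  refine div_le_one_of_le₀ ?_ (hUD.lam_pos c _ hpos).le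
  exact ENNReal.toReal_le_of_le_ofReal (hUD.lam_pos c _ hpos).le (hUD.measure_ball_le c _ hpos)

/-- At a scale which is not doubling, the density drops by a definite factor. -/
lemma density_le_of_not_doubling (hUD : IsUpperDoubling μ lam Clam) (c : X) {r : ℝ} (hr : 0 < r)
    (i : ℕ) (h : ¬ IsDoublingBall μ 6 (betaCoef Clam N0 6) c (6 ^ i * r)) :
    density μ lam c r i ≤ (Clam ^ 3)⁻¹ * density μ lam c r (i + 1) := by
  have hC : 0 < Clam := by linarith [hUD.one_lt]
  have hpos : 0 < 6 ^ i * r := by positivity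
  have hl := hUD.lam_six_mul_le c hpos
  have h0 := hUD.lam_pos c _ hpos
  have h1 := hUD.lam_pos c (6 * (6 ^ i * r)) (by positivity)
  have hβ0 : 0 ≤ betaCoef Clam N0 6 := by linarith [one_le_betaCoef (N0 := N0) hUD.one_lt]
  have hμ : Clam ^ 6 * (μ (ball c (6 ^ i * r))).toReal ≤
      (μ (ball c (6 * (6 ^ i * r)))).toReal := by
    unfold IsDoublingBall at h
    have h2 := ENNReal.toReal_mono (hUD.measure_ball_lt_top c _).ne (not_le.1 h).le
    rw [ENNReal.toReal_mul, ENNReal.toReal_ofReal hβ0] at h2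
    exact (mul_le_mul_of_nonneg_right (pow_six_le_betaCoef hUD.one_lt)
      ENNReal.toReal_nonneg).trans h2
  unfold density
  rw [show (6 : ℝ) ^ (i + 1) * r = 6 * (6 ^ i * r) by ring]
  set a := (μ (ball c (6 ^ i * r))).toReal
  set b := (μ (ball c (6 * (6 ^ i * r)))).toReal
  have ha : 0 ≤ a := ENNReal.toReal_nonneg
  rw [inv_mul_eq_div, div_div, div_le_div_iff₀ h0 (by positivity)]
  calc a * (lam c (6 * (6 ^ i * r)) * Clam ^ 3)
      ≤ a * (Clam ^ 3 * lam c (6 ^ i * r) * Clam ^ 3) := by gcongr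
    _ = Clam ^ 6 * a * lam c (6 ^ i * r) := by ring
    _ ≤ b * lam c (6 ^ i * r) := by gcongr

/-- Above every scale there is a doubling one, and a first such scale. -/
lemma exists_first_doubling (hUD : IsUpperDoubling μ lam Clam) (N0 : ℕ) (c : X) {r : ℝ}
    (hr : 0 < r) (m : ℕ) :
    ∃ j, m ≤ j ∧ IsDoublingBall μ 6 (betaCoef Clam N0 6) c (6 ^ j * r) ∧
      ∀ i, m ≤ i → i < j → ¬ IsDoublingBall μ 6 (betaCoef Clam N0 6) c (6 ^ i * r) := by
  classical
  have hex : ∃ j, m ≤ j ∧ IsDoublingBall μ 6 (betaCoef Clam N0 6) c (6 ^ j * r) := by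
    by_contra! hcon
    have hC3 : 1 < Clam ^ 3 := one_lt_pow₀ hUD.one_lt (by norm_num)
    have key : ∀ k, density μ lam c r (m + 1) ≤
        ((Clam ^ 3)⁻¹) ^ k * density μ lam c r (m + 1 + k) := by
      intro k
      induction k with
      | zero => simp
      | succ k ih =>
        refine ih.trans ?_
        rw [pow_succ _ k, mul_assoc]
        exact mul_le_mul_of_nonneg_left
          (density_le_of_not_doubling hUD c hr (m + 1 + k) (hcon _ (by omega))) (by positivity)
    have hle : ∀ k, density μ lam c r (m + 1) ≤ ((Clam ^ 3)⁻¹) ^ k := fun k =>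
      (key k).trans (mul_le_of_le_one_right (by positivity) (density_le_one hUD c hr _))
    have hlim := tendsto_pow_atTop_nhds_zero_of_lt_one (r := (Clam ^ 3)⁻¹) (by positivity)
      (inv_lt_one_of_one_lt₀ hC3)
    have hz : density μ lam c r (m + 1) ≤ 0 := ge_of_tendsto' hlim hle
    have hpos : 0 < density μ lam c r (m + 1) := by
      have h := hcon m le_rfl
      unfold IsDoublingBall at h
      refine div_pos (ENNReal.toReal_pos ?_ (hUD.measure_ball_lt_top c _).ne)
        (hUD.lam_pos c _ (by positivity))
      rw [show (6 : ℝ) ^ (m + 1) * r = 6 * (6 ^ m * r) by ring]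
      exact (lt_of_le_of_lt (zero_le) (not_le.1 h)).ne'
    linarith
  refine ⟨Nat.find hex, (Nat.find_spec hex).1, (Nat.find_spec hex).2, fun i hmi hij hd => ?_⟩
  exact Nat.find_min hex hij ⟨hmi, hd⟩

lemma exists_isSmallestDoubling (hUD : IsUpperDoubling μ lam Clam) (N0 : ℕ) (c : X) {r : ℝ}
    (hr : 0 < r) : ∃ j, IsSmallestDoubling μ 6 (betaCoef Clam N0 6) c r j :=
  exists_first_doubling hUD N0 c hr 1

/-! ### The coefficient `δ` -/

variable [BorelSpace X]

lemma sum_range_le_of_geometric {t : ℕ → ℝ} {q : ℝ} (hq : q < 1) (hq0 : 0 ≤ q)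
    (ht0 : ∀ i, 0 ≤ t i) (ht1 : ∀ i, t i ≤ 1) {m j : ℕ}
    (h : ∀ i, m ≤ i → i < j → t i ≤ q * t (i + 1)) :
    ∑ i ∈ Finset.range (j + 2), t i ≤ m + 2 + q / (1 - q) := by
  have hq1 : 0 < 1 - q := by linarith
  have hnn : 0 ≤ q / (1 - q) := by positivity
  have htriv : ∀ n : ℕ, ∑ i ∈ Finset.range n, t i ≤ n := fun n =>
    (Finset.sum_le_sum fun i _ => ht1 i).trans (by simp)
  rcases lt_or_ge j m with hjm | hmj
  · refine (htriv _).trans ?_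
    have : (j : ℝ) ≤ m := by exact_mod_cast hjm.le
    push_cast
    linarith
  · have key : ∀ n, m ≤ n → n ≤ j →
        ∑ i ∈ Finset.range n, t i ≤ m + q / (1 - q) * t n := by
      intro n hmn
      induction n, hmn using Nat.le_induction with
      | base => exact fun _ => (htriv m).trans (by nlinarith [ht0 m])
      | succ n hmn ih =>
        intro hnj
        rw [Finset.sum_range_succ]
        have h1 := ih (by omega)
        have h2 := h n hmn (by omega)
        have h3 : (q / (1 - q) + 1) * t n ≤ q / (1 - q) * t (n + 1) := by
          rw [show q / (1 - q) + 1 = (1 - q)⁻¹ by field_simp; ring, div_eq_inv_mul, mul_assoc]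
          exact mul_le_mul_of_nonneg_left h2 (by positivity)
        linarith
    rw [Finset.sum_range_succ, Finset.sum_range_succ]
    have h1 := key j hmj le_rfl
    have h2 : q / (1 - q) * t j ≤ q / (1 - q) := mul_le_of_le_one_right hnn (ht1 j)
    linarith [ht1 j, ht1 (j + 1)]

lemma delta_nonneg (hUD : IsUpperDoubling μ lam Clam) (cB : X) {rB : ℝ} (hrB : 0 < rB)
    (cS : X) (rS : ℝ) : 0 ≤ delta μ lam cB rB cS rS := by
  refine setIntegral_nonneg (measurableSet_ball.diff measurableSet_ball) fun x hx => ?_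
  have hx2 : rB ≤ dist x cB := by simpa using hx.2
  exact one_div_nonneg.2 (hUD.lam_pos cB _ (by linarith)).le

/-- On an annulus of outer radius six times the inner one, the kernel of `δ` integrates to at
most a multiple of the density. -/
lemma lintegral_annulus_le (hUD : IsUpperDoubling μ lam Clam) (c : X) {r : ℝ} (hr : 0 < r)
    (i : ℕ) :
    ∫⁻ x in ball c (6 ^ (i + 1) * r) \ ball c (6 ^ i * r), ‖1 / lam c (dist x c)‖ₑ ∂μ ≤
      ENNReal.ofReal (Clam ^ 3 * density μ lam c r (i + 1)) := by
  have hC : 0 < Clam := by linarith [hUD.one_lt]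
  have hpos : 0 < 6 ^ i * r := by positivity
  have hl0 := hUD.lam_pos c _ hpos
  have hl1 := hUD.lam_pos c (6 ^ (i + 1) * r) (by positivity)
  have hl : lam c (6 ^ (i + 1) * r) ≤ Clam ^ 3 * lam c (6 ^ i * r) := by
    rw [show (6 : ℝ) ^ (i + 1) * r = 6 * (6 ^ i * r) by ring]
    exact hUD.lam_six_mul_le c hpos
  calc ∫⁻ x in ball c (6 ^ (i + 1) * r) \ ball c (6 ^ i * r), ‖1 / lam c (dist x c)‖ₑ ∂μ
      ≤ ∫⁻ _ in ball c (6 ^ (i + 1) * r) \ ball c (6 ^ i * r),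
          ENNReal.ofReal (Clam ^ 3 / lam c (6 ^ (i + 1) * r)) ∂μ := by
        refine setLIntegral_mono' (measurableSet_ball.diff measurableSet_ball) fun x hx => ?_
        have hx2 : 6 ^ i * r ≤ dist x c := by simpa using hx.2
        have hm := hUD.lam_mono c _ _ hpos hx2
        rw [Real.enorm_of_nonneg (one_div_nonneg.2 (hl0.trans_le hm).le)]
        refine ENNReal.ofReal_le_ofReal ?_
        rw [div_le_div_iff₀ (hl0.trans_le hm) hl1, one_mul]
        exact hl.trans (by gcongr)
    _ ≤ ENNReal.ofReal (Clam ^ 3 / lam c (6 ^ (i + 1) * r)) * μ (ball c (6 ^ (i + 1) * r)) := by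
        rw [setLIntegral_const]
        gcongr
        exact sdiff_subset
    _ = ENNReal.ofReal (Clam ^ 3 * density μ lam c r (i + 1)) := by
        rw [← ENNReal.ofReal_toReal (hUD.measure_ball_lt_top c (6 ^ (i + 1) * r)).ne,
          ← ENNReal.ofReal_mul (by positivity)]
        congr 1
        unfold density
        ring

lemma exists_delta_le (hUD : IsUpperDoubling μ lam Clam) (N0 m : ℕ) :
    ∃ A : ℝ, 0 < A ∧ ∀ (c : X) (r s : ℝ) (j : ℕ), 0 < r → r ≤ s →
      (∀ i, m ≤ i → i < j → ¬ IsDoublingBall μ 6 (betaCoef Clam N0 6) c (6 ^ i * r)) →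
      delta μ lam c s c (6 ^ j * r) ≤ A := by
  have hC : 0 < Clam := by linarith [hUD.one_lt]
  have hC3 : 1 < Clam ^ 3 := one_lt_pow₀ hUD.one_lt (by norm_num)
  have hq : (Clam ^ 3)⁻¹ < 1 := inv_lt_one_of_one_lt₀ hC3
  have hq1 : 0 < 1 - (Clam ^ 3)⁻¹ := by linarith
  refine ⟨Clam ^ 3 * (m + 2 + (Clam ^ 3)⁻¹ / (1 - (Clam ^ 3)⁻¹)), by positivity, ?_⟩
  intro c r s j hr hrs hnd
  refine (ENNReal.ofReal_le_ofReal_iff (by positivity)).1 ?_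
  have hcov : ball c (2 * (6 ^ j * r)) \ ball c s ⊆
      ⋃ i : Fin (j + 1), ball c (6 ^ ((i : ℕ) + 1) * r) \ ball c (6 ^ (i : ℕ) * r) := by
    rintro x ⟨hx1, hx2⟩
    rw [mem_ball] at hx1
    have hx2 : s ≤ dist x c := by simpa using hx2
    classical
    have hex : ∃ i : ℕ, dist x c < 6 ^ (i + 1) * r :=
      ⟨j, by rw [pow_succ]; nlinarith [show 0 < 6 ^ j * r by positivity]⟩
    have hle : Nat.find hex ≤ j := Nat.find_min' hex
      (by rw [pow_succ]; nlinarith [show 0 < 6 ^ j * r by positivity])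
    refine mem_iUnion.2 ⟨⟨Nat.find hex, by omega⟩, mem_ball.2 (Nat.find_spec hex), ?_⟩
    rw [mem_ball, not_lt]
    change 6 ^ Nat.find hex * r ≤ dist x c
    rcases hn : Nat.find hex with _ | n
    · simpa using hrs.trans hx2
    · exact not_lt.1 (Nat.find_min hex (by omega : n < Nat.find hex))
  calc ENNReal.ofReal (delta μ lam c s c (6 ^ j * r))
      ≤ ‖delta μ lam c s c (6 ^ j * r)‖ₑ := Real.ofReal_le_enorm _
    _ ≤ ∫⁻ x in ball c (2 * (6 ^ j * r)) \ ball c s, ‖1 / lam c (dist x c)‖ₑ ∂μ :=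
        enorm_integral_le_lintegral_enorm _
    _ ≤ ∫⁻ x in ⋃ i : Fin (j + 1), ball c (6 ^ ((i : ℕ) + 1) * r) \ ball c (6 ^ (i : ℕ) * r),
          ‖1 / lam c (dist x c)‖ₑ ∂μ := lintegral_mono_set hcov
    _ ≤ ∑' i : Fin (j + 1), ∫⁻ x in ball c (6 ^ ((i : ℕ) + 1) * r) \ ball c (6 ^ (i : ℕ) * r),
          ‖1 / lam c (dist x c)‖ₑ ∂μ := lintegral_iUnion_le _ _
    _ ≤ ∑ i : Fin (j + 1), ENNReal.ofReal (Clam ^ 3 * density μ lam c r ((i : ℕ) + 1)) := by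
        rw [tsum_fintype]
        exact Finset.sum_le_sum fun i _ => lintegral_annulus_le hUD c hr i
    _ = ENNReal.ofReal (∑ i ∈ Finset.range (j + 1), Clam ^ 3 * density μ lam c r (i + 1)) := by
        rw [Fin.sum_univ_eq_sum_range
            (fun i => ENNReal.ofReal (Clam ^ 3 * density μ lam c r (i + 1))),
          ENNReal.ofReal_sum_of_nonneg]
        exact fun i _ => mul_nonneg (by positivity) (density_nonneg hUD c hr _)
    _ ≤ _ := by
        refine ENNReal.ofReal_le_ofReal ?_
        rw [← Finset.mul_sum]
        refine mul_le_mul_of_nonneg_left ?_ (by positivity)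
        refine le_trans ?_ (sum_range_le_of_geometric hq (by positivity)
          (density_nonneg hUD c hr) (density_le_one hUD c hr)
          fun i hmi hij => density_le_of_not_doubling hUD c hr i (hnd i hmi hij))
        rw [Finset.sum_range_succ' _ (j + 1)]
        linarith [density_nonneg hUD c hr 0]

omit [BorelSpace X] in
lemma delta_le_of_finite [IsFiniteMeasure μ] (hUD : IsUpperDoubling μ lam Clam) (cB : X) {rB : ℝ}
    (hrB : 0 < rB) (cS : X) (rS : ℝ) :
    delta μ lam cB rB cS rS ≤ 1 / lam cB rB * μ.real univ := by
  have hl := hUD.lam_pos cB rB hrB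
  refine (le_abs_self _).trans ?_
  rw [← Real.norm_eq_abs, delta]
  refine (norm_setIntegral_le_of_norm_le_const (C := 1 / lam cB rB)
    (measure_lt_top μ _) fun x hx => ?_).trans ?_
  · have hx2 : rB ≤ dist x cB := by simpa using hx.2
    have hm := hUD.lam_mono cB _ _ hrB hx2
    rw [Real.norm_of_nonneg (one_div_nonneg.2 (hl.trans_le hm).le)]
    exact one_div_le_one_div_of_le hl hm
  · exact mul_le_mul_of_nonneg_left (measureReal_mono (subset_univ _)) (by positivity)

/-! ### Geometric doubling -/

omit [MeasurableSpace X] [BorelSpace X] in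
lemma GeometricallyDoubling.exists_cover (hGD : GeometricallyDoubling X N0) (k : ℕ) (x : X)
    {r : ℝ} (hr : 0 < r) :
    ∃ s : Finset X, s.card ≤ N0 ^ k ∧ ball x r ⊆ ⋃ y ∈ s, ball y (r / 2 ^ k) := by
  classical
  induction k with
  | zero => exact ⟨{x}, by simp, by simp⟩
  | succ k ih =>
    obtain ⟨s, hs, hcov⟩ := ih
    choose t ht htcov using fun y => hGD y (r / 2 ^ k) (by positivity)
    refine ⟨s.biUnion t, ?_, fun z hz => ?_⟩
    · rw [pow_succ]
      exact (Finset.card_biUnion_le_card_mul s t N0 fun y _ => ht y).trans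
        (Nat.mul_le_mul_right _ hs)
    · obtain ⟨y, hy, hzy⟩ := mem_iUnion₂.1 (hcov hz)
      obtain ⟨w, hw, hzw⟩ := mem_iUnion₂.1 (htcov y hzy)
      refine mem_iUnion₂.2 ⟨w, Finset.mem_biUnion.2 ⟨y, hy, hw⟩, ?_⟩
      rwa [pow_succ, ← div_div]

omit [MeasurableSpace X] [BorelSpace X] in
lemma GeometricallyDoubling.secondCountableTopology (hGD : GeometricallyDoubling X N0) :
    SecondCountableTopology X := by
  refine Metric.secondCountable_of_almost_dense_set fun ε hε => ?_
  rcases isEmpty_or_nonempty X with hX | ⟨⟨x₀⟩⟩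
  · exact ⟨∅, countable_empty, fun x => hX.elim x⟩
  have hk : ∀ n : ℕ, ∃ k : ℕ, ((n : ℝ) + 1) / 2 ^ k < ε := fun n => by
    obtain ⟨k, hk⟩ := pow_unbounded_of_one_lt (((n : ℝ) + 1) / ε) (one_lt_two)
    exact ⟨k, by rw [div_lt_iff₀ (by positivity)]; rw [div_lt_iff₀ hε] at hk; linarith⟩
  choose k hk using hk
  choose s _ hcov using fun n : ℕ =>
    hGD.exists_cover (k n) x₀ (r := (n : ℝ) + 1) (by positivity)
  refine ⟨⋃ n, (s n : Set X), countable_iUnion fun n => (s n).countable_toSet, fun x => ?_⟩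
  obtain ⟨n, hn⟩ := exists_nat_gt (dist x x₀)
  obtain ⟨y, hy, hxy⟩ := mem_iUnion₂.1 (hcov n (mem_ball.2 (by linarith)))
  exact ⟨y, mem_iUnion.2 ⟨n, hy⟩, ((mem_ball.1 hxy).trans (hk n)).le⟩

/-! ### The maximal operators -/

/-- Weak type estimate: a set each of whose points lies in a doubling ball inside `D` on which `g`
has mean at least `t`. -/
lemma mul_measure_le_of_doubling_balls [SecondCountableTopology X] {b t : ℝ≥0∞} {g : X → ℝ≥0∞}
    {A D : Set X} {R : ℝ}
    (h : ∀ y ∈ A, ∃ (c : X) (r : ℝ), 0 < r ∧ r ≤ R ∧ y ∈ ball c r ∧ ball c r ⊆ D ∧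
      μ (ball c (6 * r)) ≤ b * μ (ball c r) ∧ t * μ (ball c r) ≤ ∫⁻ x in ball c r, g x ∂μ) :
    t * μ A ≤ b * ∫⁻ x in D, g x ∂μ := by
  choose! c r hr hR hmem hD hdoub hg using h
  obtain ⟨u, huA, hdisj, hcov⟩ := Vitali.exists_disjoint_subfamily_covering_enlargement
    (fun y => ball (c y) (r y)) A r 2 one_lt_two (fun y hy => (hr y hy).le) R hR
    fun y hy => ⟨y, hmem y hy⟩
  have hcount : u.Countable := hdisj.countable_of_isOpen (fun _ _ => isOpen_ball)
    fun y hy => ⟨y, hmem y (huA hy)⟩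
  have hsub : A ⊆ ⋃ y ∈ u, ball (c y) (6 * r y) := by
    intro y hy
    obtain ⟨z, hz, ⟨w, hw1, hw2⟩, hle⟩ := hcov y hy
    refine mem_iUnion₂.2 ⟨z, hz, ?_⟩
    have h1 := mem_ball.1 (hmem y hy)
    have h2 := mem_ball'.1 hw1
    have h3 := mem_ball.1 hw2
    have h4 := hr z (huA hz)
    rw [mem_ball]
    linarith [dist_triangle4 y (c y) w (c z)]
  calc t * μ A ≤ t * ∑' y : u, μ (ball (c y) (6 * r y)) := by
        gcongr
        exact (measure_mono hsub).trans (measure_biUnion_le μ hcount _)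
    _ = ∑' y : u, t * μ (ball (c y) (6 * r y)) := ENNReal.tsum_mul_left.symm
    _ ≤ ∑' y : u, b * ∫⁻ x in ball (c y) (r y), g x ∂μ := by
        refine ENNReal.tsum_le_tsum fun y => ?_
        calc t * μ (ball (c y) (6 * r y)) ≤ t * (b * μ (ball (c y) (r y))) := by
              gcongr; exact hdoub y (huA y.2)
          _ = b * (t * μ (ball (c y) (r y))) := by ring
          _ ≤ _ := by gcongr; exact hg y (huA y.2)
    _ = b * ∫⁻ x in ⋃ y ∈ u, ball (c y) (r y), g x ∂μ := by
        rw [ENNReal.tsum_mul_left, lintegral_biUnion hcount (fun _ _ => measurableSet_ball) hdisj]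
    _ ≤ b * ∫⁻ x in D, g x ∂μ := by
        gcongr
        exact iUnion₂_subset fun y hy => hD y (huA hy)

omit [BorelSpace X] in
lemma lt_maxN_of_mem_ball (hUD : IsUpperDoubling μ lam Clam) {β : ℝ} {L : ℝ≥0∞} (hL : L ≠ ∞)
    {c x : X} {r : ℝ} (hr : 0 < r) (hx : x ∈ ball c r) (hd : IsDoublingBall μ 6 β c r)
    (h : L * μ (ball c r) < ∫⁻ y in ball c r, ENNReal.ofReal |f y| ∂μ) :
    L < maxN μ β f x := by
  have h1 : L < (∫⁻ y in ball c r, ENNReal.ofReal |f y| ∂μ) / μ (ball c r) :=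
    (ENNReal.lt_div_iff_mul_lt (Or.inr hL) (Or.inl (hUD.measure_ball_lt_top c r).ne)).2 h
  refine h1.trans_le ?_
  unfold maxN
  exact le_iSup_of_le c <| le_iSup_of_le r <| le_iSup_of_le hr <| le_iSup_of_le hx <|
    le_iSup_of_le hd le_rfl

omit [BorelSpace X] in
lemma exists_ball_of_lt_maxN (hUD : IsUpperDoubling μ lam Clam) {β : ℝ} {L : ℝ≥0∞} (hL : L ≠ ∞)
    {x : X} (h : L < maxN μ β f x) :
    ∃ (c : X) (r : ℝ), 0 < r ∧ x ∈ ball c r ∧ IsDoublingBall μ 6 β c r ∧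
      L * μ (ball c r) < ∫⁻ y in ball c r, ENNReal.ofReal |f y| ∂μ := by
  unfold maxN at h
  simp only [lt_iSup_iff] at h
  obtain ⟨c, r, hr, hx, hd, h⟩ := h
  exact ⟨c, r, hr, hx, hd,
    (ENNReal.lt_div_iff_mul_lt (Or.inr hL) (Or.inl (hUD.measure_ball_lt_top c r).ne)).1 h⟩

omit [BorelSpace X] in
lemma lintegral_sub_ballAvg_le (hUD : IsUpperDoubling μ lam Clam) {c x : X} {r : ℝ} {j : ℕ}
    (hr : 0 < r) (hx : x ∈ ball c r) (hj : IsSmallestDoubling μ 6 (betaCoef Clam N0 6) c r j) :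
    ∫⁻ y in ball c r, ENNReal.ofReal |f y - ballAvg μ f c (6 ^ j * r)| ∂μ ≤
      sharpM μ lam Clam N0 f x * μ (ball c (5 * r)) := by
  have hle : (∫⁻ y in ball c r, ENNReal.ofReal |f y - ballAvg μ f c (6 ^ j * r)| ∂μ) /
      μ (ball c (5 * r)) ≤ sharpM μ lam Clam N0 f x := by
    unfold sharpM
    refine le_add_right ?_
    exact le_iSup_of_le c <| le_iSup_of_le r <| le_iSup_of_le j <| le_iSup_of_le hr <|
      le_iSup_of_le hx <| le_iSup_of_le hj le_rfl
  rcases eq_or_ne (μ (ball c (5 * r))) 0 with h0 | h0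
  · have : μ (ball c r) = 0 := measure_mono_null (ball_subset_ball (by linarith)) h0
    rw [setLIntegral_measure_zero _ _ this]
    exact zero_le
  · exact (ENNReal.div_le_iff h0 (hUD.measure_ball_lt_top c _).ne).1 hle

lemma ofReal_ballAvg_sub_le (hUD : IsUpperDoubling μ lam Clam) {cB cS x : X} {rB rS A : ℝ}
    (hrB : 0 < rB) (hrS : 0 < rS) (hx : x ∈ ball cB rB) (hBS : ball cB rB ⊆ ball cS rS)
    (hB : IsDoublingBall μ 6 (betaCoef Clam N0 6) cB rB)
    (hS : IsDoublingBall μ 6 (betaCoef Clam N0 6) cS rS) (hA : delta μ lam cB rB cS rS ≤ A) :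
    ENNReal.ofReal |ballAvg μ f cB rB - ballAvg μ f cS rS| ≤
      sharpM μ lam Clam N0 f x * ENNReal.ofReal (1 + A) := by
  have hδ := delta_nonneg hUD cB hrB cS rS
  have hle : ENNReal.ofReal (|ballAvg μ f cB rB - ballAvg μ f cS rS| /
      (1 + delta μ lam cB rB cS rS)) ≤ sharpM μ lam Clam N0 f x := by
    unfold sharpM
    refine le_add_left ?_
    exact le_iSup_of_le cB <| le_iSup_of_le rB <| le_iSup_of_le cS <| le_iSup_of_le rS <|
      le_iSup_of_le hrB <| le_iSup_of_le hrS <| le_iSup_of_le hx <| le_iSup_of_le hBS <|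
      le_iSup_of_le hB <| le_iSup_of_le hS le_rfl
  calc ENNReal.ofReal |ballAvg μ f cB rB - ballAvg μ f cS rS|
      = ENNReal.ofReal (|ballAvg μ f cB rB - ballAvg μ f cS rS| /
          (1 + delta μ lam cB rB cS rS)) * ENNReal.ofReal (1 + delta μ lam cB rB cS rS) := by
        rw [← ENNReal.ofReal_mul (by positivity), div_mul_cancel₀ _ (by positivity)]
    _ ≤ _ := by gcongr

omit [MeasurableSpace X] [BorelSpace X] [MetricSpace X] in
lemma ofReal_abs_le_add (a b : ℝ) :
    ENNReal.ofReal |a| ≤ ENNReal.ofReal |a - b| + ENNReal.ofReal |b| := by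
  rw [← ENNReal.ofReal_add (abs_nonneg _) (abs_nonneg _)]
  refine ENNReal.ofReal_le_ofReal ?_
  simpa using abs_add_le (a - b) b

omit [MetricSpace X] [BorelSpace X] in
lemma lintegral_abs_le_add (f : X → ℝ) (m : ℝ) (s : Set X) :
    ∫⁻ y in s, ENNReal.ofReal |f y| ∂μ ≤
      ∫⁻ y in s, ENNReal.ofReal |f y - m| ∂μ + ENNReal.ofReal |m| * μ s := by
  rw [← setLIntegral_const, ← lintegral_add_right _ measurable_const]
  exact lintegral_mono fun y => ofReal_abs_le_add _ _

omit [BorelSpace X] in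
lemma ofReal_abs_ballAvg_mul_le (hUD : IsUpperDoubling μ lam Clam) (f : X → ℝ) (c : X) (r : ℝ) :
    ENNReal.ofReal |ballAvg μ f c r| * μ (ball c r) ≤
      ∫⁻ y in ball c r, ENNReal.ofReal |f y| ∂μ := by
  have htop := (hUD.measure_ball_lt_top c r).ne
  rcases eq_or_ne (μ (ball c r)) 0 with h0 | h0
  · simp [h0]
  · have hpos := ENNReal.toReal_pos h0 htop
    calc ENNReal.ofReal |ballAvg μ f c r| * μ (ball c r)
        = ENNReal.ofReal |∫ y in ball c r, f y ∂μ| := by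
          nth_rewrite 1 [← ENNReal.ofReal_toReal htop]
          rw [← ENNReal.ofReal_mul (abs_nonneg _), ballAvg, abs_div, abs_of_pos hpos,
            div_mul_cancel₀ _ hpos.ne']
      _ = ‖∫ y in ball c r, f y ∂μ‖ₑ := (Real.enorm_eq_ofReal_abs _).symm
      _ ≤ ∫⁻ y in ball c r, ‖f y‖ₑ ∂μ := enorm_integral_le_lintegral_enorm _
      _ = _ := by simp only [Real.enorm_eq_ofReal_abs]

/-! ### Spaces of finite measure -/

omit [MeasurableSpace X] [BorelSpace X] in
lemma monotone_ball_pow_six (x : X) : Monotone fun k : ℕ => ball x ((6 : ℝ) ^ k) :=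
  fun _ _ h => ball_subset_ball (pow_le_pow_right₀ (by norm_num) h)

omit [MeasurableSpace X] [BorelSpace X] in
lemma iUnion_ball_pow_six (x : X) : ⋃ k : ℕ, ball x ((6 : ℝ) ^ k) = univ := by
  refine eq_univ_of_forall fun y => ?_
  obtain ⟨k, hk⟩ := pow_unbounded_of_one_lt (dist y x) (show (1 : ℝ) < 6 by norm_num)
  exact mem_iUnion.2 ⟨k, hk⟩

omit [BorelSpace X] in
lemma tendsto_measure_ball_pow_six (ν : Measure X) (x : X) :
    Tendsto (fun k : ℕ => ν (ball x ((6 : ℝ) ^ k))) atTop (𝓝 (ν univ)) := by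
  rw [← iUnion_ball_pow_six x]
  exact tendsto_measure_iUnion_atTop (monotone_ball_pow_six x)

lemma tendsto_lintegral_ball_pow_six (g : X → ℝ≥0∞) (x : X) :
    Tendsto (fun k : ℕ => ∫⁻ y in ball x ((6 : ℝ) ^ k), g y ∂μ) atTop (𝓝 (∫⁻ y, g y ∂μ)) := by
  have h := tendsto_measure_ball_pow_six (μ.withDensity g) x
  simpa [withDensity_apply _ measurableSet_ball, withDensity_apply _ MeasurableSet.univ] using h

/-- In a space of finite measure, the mean of `|f|` is controlled by the sharp maximal function
at every point. -/
lemma lintegral_abs_le_sharpM_mul [IsFiniteMeasure μ] [SecondCountableTopology X]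
    (hUD : IsUpperDoubling μ lam Clam) (hf : LocallyIntegrable f μ) (h0 : ∫ x, f x ∂μ = 0)
    (x : X) :
    ∫⁻ y, ENNReal.ofReal |f y| ∂μ ≤ sharpM μ lam Clam N0 f x * μ univ := by
  rcases eq_or_ne (μ univ) 0 with hμ | hμ
  · simp [Measure.measure_univ_eq_zero.1 hμ]
  set M := sharpM μ lam Clam N0 f x
  rcases eq_or_ne M ∞ with hMtop | hMtop
  · simp [hMtop, ENNReal.top_mul hμ]
  set a : ℕ → ℝ := fun n => ballAvg μ f x (6 ^ n)
  choose j hj using fun k : ℕ => exists_isSmallestDoubling hUD N0 x (r := 6 ^ k) (by positivity)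
  have hrad : ∀ k, (6 : ℝ) ^ j k * 6 ^ k = 6 ^ (j k + k) := fun k => (pow_add _ _ _).symm
  have hle : ∀ k, ∫⁻ y in ball x (6 ^ k), ENNReal.ofReal |f y| ∂μ ≤
      (M + ENNReal.ofReal |a (j k + k)|) * μ univ := by
    intro k
    have h1 := lintegral_sub_ballAvg_le (f := f) hUD (by positivity : (0 : ℝ) < 6 ^ k)
      (mem_ball_self (by positivity)) (hj k)
    rw [hrad] at h1
    rw [add_mul]
    refine (lintegral_abs_le_add f (a (j k + k)) _).trans ?_
    gcongr
    · exact h1.trans (by gcongr; exact subset_univ _)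
    · exact subset_univ _
  have hlim := tendsto_lintegral_ball_pow_six (μ := μ) (fun y => ENNReal.ofReal |f y|) x
  have hfin : ∫⁻ y, ENNReal.ofReal |f y| ∂μ < ∞ := by
    obtain ⟨n, -, hn, -⟩ := exists_first_doubling hUD N0 x one_pos 0
    rw [mul_one] at hn
    set A := 1 / lam x (6 ^ n) * μ.real univ
    have hbd : ∀ k, n ≤ k → ∫⁻ y in ball x (6 ^ k), ENNReal.ofReal |f y| ∂μ ≤
        (M + (M * ENNReal.ofReal (1 + A) + ENNReal.ofReal |a n|)) * μ univ := by
      intro k hk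
      refine (hle k).trans ?_
      gcongr
      refine (ofReal_abs_le_add _ (a n)).trans ?_
      gcongr
      rw [abs_sub_comm]
      have hdk := (hj k).2.1
      rw [hrad] at hdk
      exact ofReal_ballAvg_sub_le hUD (by positivity) (by positivity)
        (mem_ball_self (by positivity)) (monotone_ball_pow_six x (by omega)) hn hdk
        (delta_le_of_finite hUD x (by positivity) x _)
    refine (le_of_tendsto hlim (eventually_atTop.2 ⟨n, hbd⟩)).trans_lt ?_
    finiteness
  have hf_integrable : Integrable f μ := by
    refine ⟨hf.aestronglyMeasurable, ?_⟩
    simpa only [HasFiniteIntegral, Real.enorm_eq_ofReal_abs] using hfin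
  have ha0 : Tendsto a atTop (𝓝 0) := by
    have h1 : Tendsto (fun n : ℕ => ∫ y in ball x ((6 : ℝ) ^ n), f y ∂μ) atTop (𝓝 0) := by
      have := tendsto_setIntegral_of_monotone (μ := μ) (f := f)
        (fun n : ℕ => (measurableSet_ball : MeasurableSet (ball x ((6 : ℝ) ^ n))))
        (monotone_ball_pow_six x) hf_integrable.integrableOn
      rwa [iUnion_ball_pow_six, setIntegral_univ, h0] at this
    have h2 : Tendsto (fun n : ℕ => (μ (ball x ((6 : ℝ) ^ n))).toReal) atTop
        (𝓝 (μ univ).toReal) :=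
      (ENNReal.tendsto_toReal (measure_ne_top μ _)).comp (tendsto_measure_ball_pow_six μ x)
    have h3 := h1.div h2 (ENNReal.toReal_pos hμ (measure_ne_top μ _)).ne'
    rw [zero_div] at h3
    exact h3
  have hj_lim : Tendsto (fun k => j k + k) atTop atTop :=
    tendsto_atTop_mono (fun k => Nat.le_add_left k (j k)) tendsto_id
  have hb0 : Tendsto (fun k => (M + ENNReal.ofReal |a (j k + k)|) * μ univ) atTop
      (𝓝 (M * μ univ)) := by
    have h1 : Tendsto (fun k => ENNReal.ofReal |a (j k + k)|) atTop (𝓝 0) := by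
      simpa using ENNReal.tendsto_ofReal ((ha0.comp hj_lim).abs)
    have h2 := ENNReal.Tendsto.mul_const (h1.const_add M) (Or.inr (measure_ne_top μ univ))
    simpa using h2
  exact le_of_tendsto_of_tendsto' hlim hb0 hle

/-! ### The good-`λ` inequality -/

omit [BorelSpace X] in
/-- Doubling balls of large radius meeting a fixed ball do not carry a large mean of `|f|`. -/
lemma exists_radius_bound (hUD : IsUpperDoubling μ lam Clam) {β : ℝ} (hβ : 1 ≤ β) {L : ℝ≥0∞}
    (hL : L ≠ ∞) (hfin : μ {x | L < maxN μ β f x} < ∞)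
    (hsmall : μ univ ≠ ∞ →
      2 * ENNReal.ofReal β * ∫⁻ y, ENNReal.ofReal |f y| ∂μ ≤ L * μ univ) (x₀ : X) (R₀ : ℝ) :
    ∃ R : ℝ, ∀ x ∈ ball x₀ R₀, ∀ (c : X) (r : ℝ), R ≤ r → 0 < r → x ∈ ball c r →
      IsDoublingBall μ 6 β c r →
      ∫⁻ y in ball c r, ENNReal.ofReal |f y| ∂μ ≤ L * μ (ball c r) := by
  have hb0 : ENNReal.ofReal β ≠ 0 := by simpa using by linarith
  have hlim := tendsto_measure_ball_pow_six μ x₀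
  have hsub : ∀ (n : ℕ) (x c : X) (r : ℝ), x ∈ ball x₀ R₀ → max (6 ^ n) R₀ ≤ r → x ∈ ball c r →
      ball x₀ (6 ^ n) ⊆ ball c (6 * r) := by
    intro n x c r hx hr hxc z hz
    have h1 := (le_max_left _ _).trans hr
    have h2 := (le_max_right _ _).trans hr
    have h3 := mem_ball'.1 hx
    have h4 := mem_ball.1 hxc
    have h5 := mem_ball.1 hz
    have h6 : 0 ≤ dist z x₀ := dist_nonneg
    rw [mem_ball]
    linarith [dist_triangle4 z x₀ x c]
  rcases eq_or_ne (μ univ) ∞ with htop | htop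
  · rw [htop] at hlim
    obtain ⟨n, hn⟩ := (hlim.eventually (lt_mem_nhds
      (show ENNReal.ofReal β * μ {x | L < maxN μ β f x} < ∞ by finiteness))).exists
    refine ⟨max (6 ^ n) R₀, fun x hx c r hr hr0 hxc hd => ?_⟩
    by_contra! hcon
    have hΩ : ball c r ⊆ {x | L < maxN μ β f x} := fun y hy =>
      lt_maxN_of_mem_ball hUD hL hr0 hy hd hcon
    have h1 := (measure_mono (hsub n x c r hx hr hxc)).trans hd
    exact absurd (h1.trans (mul_le_mul_right (measure_mono hΩ) _)) (not_le.2 hn)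
  · obtain ⟨n, hn⟩ : ∃ n : ℕ, μ univ ≤ 2 * μ (ball x₀ (6 ^ n)) := by
      rcases eq_or_ne (μ univ) 0 with h0 | h0
      · exact ⟨0, by simp [h0]⟩
      · obtain ⟨n, hn⟩ := (hlim.eventually (lt_mem_nhds (ENNReal.half_lt_self h0 htop))).exists
        refine ⟨n, ?_⟩
        rw [mul_comm]
        exact (ENNReal.div_le_iff (by simp) (by simp)).1 hn.le
    refine ⟨max (6 ^ n) R₀, fun x hx c r hr hr0 hxc hd => ?_⟩
    have hle : 2 * ENNReal.ofReal β * ∫⁻ y in ball c r, ENNReal.ofReal |f y| ∂μ ≤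
        2 * ENNReal.ofReal β * (L * μ (ball c r)) :=
      calc 2 * ENNReal.ofReal β * ∫⁻ y in ball c r, ENNReal.ofReal |f y| ∂μ
          ≤ 2 * ENNReal.ofReal β * ∫⁻ y, ENNReal.ofReal |f y| ∂μ := by
            gcongr
            exact Measure.restrict_le_self
        _ ≤ L * μ univ := hsmall htop
        _ ≤ L * (2 * (ENNReal.ofReal β * μ (ball c r))) := by
            gcongr
            refine hn.trans ?_
            gcongr
            exact (measure_mono (hsub n x c r hx hr hxc)).trans hd
        _ = 2 * ENNReal.ofReal β * (L * μ (ball c r)) := by ring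
    exact (ENNReal.mul_le_mul_iff_right (mul_ne_zero two_ne_zero hb0) (by finiteness)).1 hle

/-- The stopping balls: an almost largest ball `ball c r` around `x` with large mean of `|f|`,
together with a doubling dilate on which the mean of `|f|` is still larger than `L`. -/
lemma exists_stopping_ball (hUD : IsUpperDoubling μ lam Clam) {A : ℝ}
    (hA : ∀ (c : X) (r s : ℝ) (j : ℕ), 0 < r → r ≤ s →
      (∀ i, 3 ≤ i → i < j → ¬ IsDoublingBall μ 6 (betaCoef Clam N0 6) c (6 ^ i * r)) →
      delta μ lam c s c (6 ^ j * r) ≤ A)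
    {L γ : ℝ≥0∞} (hL : L ≠ ∞)
    (hγ : (ENNReal.ofReal (betaCoef Clam N0 6) + ENNReal.ofReal (1 + A)) * γ ≤ 1)
    {x : X} (hx : 2 * L < maxN μ (betaCoef Clam N0 6) f x)
    (hsharp : sharpM μ lam Clam N0 f x ≤ γ * L) {R : ℝ}
    (hR : ∀ (c : X) (r : ℝ), R ≤ r → 0 < r → x ∈ ball c r →
      IsDoublingBall μ 6 (betaCoef Clam N0 6) c r →
      ∫⁻ y in ball c r, ENNReal.ofReal |f y| ∂μ ≤ L * μ (ball c r)) :
    ∃ (c : X) (s : ℝ), 0 < s ∧ s ≤ R ∧ x ∈ ball c s ∧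
      IsDoublingBall μ 6 (betaCoef Clam N0 6) c s ∧
      L * μ (ball c s) < ∫⁻ y in ball c s, ENNReal.ofReal |f y| ∂μ ∧
      ∀ (c' : X) (r' : ℝ), s / 108 ≤ r' → x ∈ ball c' r' →
        IsDoublingBall μ 6 (betaCoef Clam N0 6) c' r' →
        ∫⁻ y in ball c' r', ENNReal.ofReal |f y| ∂μ ≤ 2 * L * μ (ball c' r') := by
  set b := ENNReal.ofReal (betaCoef Clam N0 6)
  have h2L : 2 * L ≠ ∞ := by finiteness
  set T : Set ℝ := {r | 0 < r ∧ ∃ c, x ∈ ball c r ∧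
    IsDoublingBall μ 6 (betaCoef Clam N0 6) c r ∧
    2 * L * μ (ball c r) < ∫⁻ y in ball c r, ENNReal.ofReal |f y| ∂μ}
  have hTne : T.Nonempty := by
    obtain ⟨c, r, hr, hxc, hd, h⟩ := exists_ball_of_lt_maxN hUD h2L hx
    exact ⟨r, hr, c, hxc, hd, h⟩
  have hTbdd : BddAbove T := by
    refine ⟨R, ?_⟩
    rintro r ⟨hr, c, hxc, hd, h⟩
    by_contra! hcon
    refine absurd h (not_lt.2 ((hR c r hcon.le hr hxc hd).trans ?_))
    gcongr
    exact le_mul_of_one_le_left zero_le one_le_two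
  have hsup : 0 < sSup T := by
    obtain ⟨r, hr⟩ := hTne
    exact hr.1.trans_le (le_csSup hTbdd hr)
  obtain ⟨r, ⟨hr, c, hxc, hd, h⟩, hrsup⟩ := exists_lt_of_lt_csSup hTne (half_lt_self hsup)
  obtain ⟨i, hi⟩ := exists_isSmallestDoubling hUD N0 c hr
  obtain ⟨j, hj3, hdj, hjmin⟩ := exists_first_doubling hUD N0 c hr 3
  have hij : i ≤ j := by
    by_contra! hcon
    exact hi.2.2 j (by omega) hcon hdj
  have hri : r ≤ 6 ^ i * r := le_mul_of_one_le_left hr.le (one_le_pow₀ (by norm_num))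
  have hrij : (6 : ℝ) ^ i * r ≤ 6 ^ j * r := by gcongr; norm_num
  have hr216 : 216 * r ≤ 6 ^ j * r := by
    have : (6 : ℝ) ^ 3 ≤ 6 ^ j := pow_le_pow_right₀ (by norm_num) hj3
    nlinarith
  have hxi : x ∈ ball c (6 ^ i * r) := ball_subset_ball hri hxc
  have hxj : x ∈ ball c (6 ^ j * r) := ball_subset_ball hrij hxi
  set mi := ballAvg μ f c (6 ^ i * r)
  set mj := ballAvg μ f c (6 ^ j * r)
  have hosc : ∫⁻ y in ball c r, ENNReal.ofReal |f y - mi| ∂μ ≤ γ * L * (b * μ (ball c r)) := by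
    refine (lintegral_sub_ballAvg_le hUD hr hxc hi).trans ?_
    gcongr
    exact (measure_mono (ball_subset_ball (by linarith))).trans hd
  have hmij : ENNReal.ofReal |mi - mj| ≤ γ * L * ENNReal.ofReal (1 + A) := by
    refine (ofReal_ballAvg_sub_le hUD (by positivity) (by positivity) hxi
      (ball_subset_ball hrij) hi.2.1 hdj (hA c r _ j hr hri hjmin)).trans ?_
    gcongr
  have hmj : L < ENNReal.ofReal |mj| := by
    by_contra! hcon
    refine absurd h (not_lt.2 ?_)
    calc ∫⁻ y in ball c r, ENNReal.ofReal |f y| ∂μ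
        ≤ γ * L * (b * μ (ball c r)) + ENNReal.ofReal |mi| * μ (ball c r) :=
          (lintegral_abs_le_add f mi _).trans (by gcongr)
      _ ≤ γ * L * (b * μ (ball c r)) + (γ * L * ENNReal.ofReal (1 + A) + L) * μ (ball c r) := by
          gcongr
          exact (ofReal_abs_le_add mi mj).trans (by gcongr)
      _ = (b + ENNReal.ofReal (1 + A)) * γ * (L * μ (ball c r)) + L * μ (ball c r) := by ring
      _ ≤ 1 * (L * μ (ball c r)) + L * μ (ball c r) := by gcongr
      _ = 2 * L * μ (ball c r) := by ring
  have hμ0 : μ (ball c r) ≠ 0 := by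
    intro h0
    rw [setLIntegral_measure_zero _ _ h0] at h
    exact not_lt_zero h
  have hμj0 : μ (ball c (6 ^ j * r)) ≠ 0 := fun h0 =>
    hμ0 (measure_mono_null (ball_subset_ball (hri.trans hrij)) h0)
  have hjbig : L * μ (ball c (6 ^ j * r)) <
      ∫⁻ y in ball c (6 ^ j * r), ENNReal.ofReal |f y| ∂μ :=
    ((ENNReal.mul_lt_mul_iff_left hμj0 (hUD.measure_ball_lt_top c _).ne).2 hmj).trans_le
      (ofReal_abs_ballAvg_mul_le hUD f c _)
  refine ⟨c, 6 ^ j * r, by positivity, ?_, hxj, hdj, hjbig, fun c' r' hr' hxc' hd' => ?_⟩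
  · by_contra! hcon
    exact absurd (hR c _ hcon.le (by positivity) hxj hdj) (not_le.2 hjbig)
  · by_contra! hcon
    have hmem : r' ∈ T := ⟨by linarith, c', hxc', hd', hcon⟩
    linarith [le_csSup hTbdd hmem]

/-- The local estimate on a small portion of a stopping ball. -/
lemma measure_local_le [SecondCountableTopology X] (hUD : IsUpperDoubling μ lam Clam)
    {L γ : ℝ≥0∞} (hL : L ≠ ∞) (hL0 : L ≠ 0) {c z : X} {s : ℝ} (hs : 0 < s)
    (hd : IsDoublingBall μ 6 (betaCoef Clam N0 6) c s) {E : Set X}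
    (hEz : E ⊆ ball z (s / 20)) (hEc : E ⊆ ball c (5 * s))
    (hEN : ∀ y ∈ E, 3 * L < maxN μ (betaCoef Clam N0 6) f y)
    (hEsharp : ∀ y ∈ E, sharpM μ lam Clam N0 f y ≤ γ * L)
    (hEmax : ∀ y ∈ E, ∀ (c' : X) (r' : ℝ), s / 54 ≤ r' → y ∈ ball c' r' →
      IsDoublingBall μ 6 (betaCoef Clam N0 6) c' r' →
      ∫⁻ w in ball c' r', ENNReal.ofReal |f w| ∂μ ≤ 2 * L * μ (ball c' r')) :
    μ E ≤ ENNReal.ofReal (betaCoef Clam N0 6) ^ 2 * γ * μ (ball c s) := by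
  set b := ENNReal.ofReal (betaCoef Clam N0 6)
  rcases E.eq_empty_or_nonempty with rfl | ⟨y₀, hy₀⟩
  · simp
  have hs5 : 0 < s / 5 := by positivity
  obtain ⟨j, hj⟩ := exists_isSmallestDoubling hUD N0 y₀ hs5
  set m := ballAvg μ f y₀ (6 ^ j * (s / 5))
  have hrad : s / 5 ≤ 6 ^ j * (s / 5) :=
    le_mul_of_one_le_left hs5.le (one_le_pow₀ (by norm_num))
  have hm_le : ENNReal.ofReal |m| * μ (ball y₀ (6 ^ j * (s / 5))) ≤
      2 * L * μ (ball y₀ (6 ^ j * (s / 5))) :=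
    (ofReal_abs_ballAvg_mul_le hUD f _ _).trans
      (hEmax y₀ hy₀ _ _ (by linarith) (mem_ball_self (by linarith)) hj.2.1)
  have hosc : ∫⁻ y in ball y₀ (s / 5), ENNReal.ofReal |f y - m| ∂μ ≤
      γ * L * (b * μ (ball c s)) := by
    refine (lintegral_sub_ballAvg_le hUD hs5 (mem_ball_self hs5) hj).trans ?_
    gcongr
    · exact hEsharp y₀ hy₀
    · refine (measure_mono ?_).trans hd
      refine ball_subset_ball' ?_
      linarith [mem_ball.1 (hEc hy₀)]
  have hweak : L * μ E ≤ b * ∫⁻ y in ball y₀ (s / 5), ENNReal.ofReal |f y - m| ∂μ := by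
    refine mul_measure_le_of_doubling_balls (R := s) fun y hy => ?_
    obtain ⟨c', r', hr', hyc', hd', h⟩ :=
      exists_ball_of_lt_maxN hUD (by finiteness) (hEN y hy)
    have htop := (hUD.measure_ball_lt_top c' r').ne
    have hr's : r' < s / 54 := by
      by_contra! hcon
      refine absurd (hEmax y hy c' r' hcon hyc' hd') (not_le.2 (lt_of_le_of_lt ?_ h))
      gcongr
      norm_num
    have hsub : ball c' r' ⊆ ball y₀ (s / 5) := by
      refine ball_subset_ball' ?_
      have h1 := mem_ball'.1 hyc'
      have h2 := mem_ball.1 (hEz hy)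
      have h3 := mem_ball'.1 (hEz hy₀)
      linarith [dist_triangle4 c' y z y₀]
    refine ⟨c', r', hr', by linarith, hyc', hsub, hd', ?_⟩
    rcases eq_or_ne (μ (ball y₀ (6 ^ j * (s / 5)))) 0 with h0 | h0
    · have : μ (ball c' r') = 0 :=
        measure_mono_null (hsub.trans (ball_subset_ball hrad)) h0
      simp [this]
    · have hm2 : ENNReal.ofReal |m| ≤ 2 * L :=
        (ENNReal.mul_le_mul_iff_left h0 (hUD.measure_ball_lt_top _ _).ne).1 hm_le
      have h1 : L * μ (ball c' r') + 2 * L * μ (ball c' r') ≤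
          ∫⁻ y in ball c' r', ENNReal.ofReal |f y - m| ∂μ + 2 * L * μ (ball c' r') :=
        calc L * μ (ball c' r') + 2 * L * μ (ball c' r') = 3 * L * μ (ball c' r') := by ring
          _ ≤ _ := h.le
          _ ≤ _ := lintegral_abs_le_add f m _
          _ ≤ _ := by gcongr
      exact (ENNReal.add_le_add_iff_right (by finiteness)).1 h1
  refine (ENNReal.mul_le_mul_iff_right hL0 hL).1 ?_
  calc L * μ E ≤ b * (γ * L * (b * μ (ball c s))) := hweak.trans (by gcongr)
    _ = L * (b ^ 2 * γ * μ (ball c s)) := by ring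

lemma measure_good_lambda_le (hUD : IsUpperDoubling μ lam Clam)
    (hGD : GeometricallyDoubling X N0) {A : ℝ}
    (hA : ∀ (c : X) (r s : ℝ) (j : ℕ), 0 < r → r ≤ s →
      (∀ i, 3 ≤ i → i < j → ¬ IsDoublingBall μ 6 (betaCoef Clam N0 6) c (6 ^ i * r)) →
      delta μ lam c s c (6 ^ j * r) ≤ A)
    {L γ : ℝ≥0∞} (hL : L ≠ ∞) (hL0 : L ≠ 0)
    (hγβ : 2 * ENNReal.ofReal (betaCoef Clam N0 6) * γ ≤ 1)
    (hγA : (ENNReal.ofReal (betaCoef Clam N0 6) + ENNReal.ofReal (1 + A)) * γ ≤ 1)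
    (hf : LocallyIntegrable f μ) (hf0 : μ univ ≠ ∞ → ∫ x, f x ∂μ = 0)
    (hfin : μ {x | L < maxN μ (betaCoef Clam N0 6) f x} < ∞) :
    μ {x | 3 * L < maxN μ (betaCoef Clam N0 6) f x ∧ sharpM μ lam Clam N0 f x ≤ γ * L} ≤
      N0 ^ 7 * (ENNReal.ofReal (betaCoef Clam N0 6) ^ 2 * γ) *
        μ {x | L < maxN μ (betaCoef Clam N0 6) f x} := by
  have := hGD.secondCountableTopology
  set β := betaCoef Clam N0 6
  set b := ENNReal.ofReal β
  set E := {x | 3 * L < maxN μ β f x ∧ sharpM μ lam Clam N0 f x ≤ γ * L}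
  rcases E.eq_empty_or_nonempty with hemp | ⟨x₀, hx₀⟩
  · simp [hemp]
  have hsmall : μ univ ≠ ∞ → 2 * b * ∫⁻ y, ENNReal.ofReal |f y| ∂μ ≤ L * μ univ := by
    intro htop
    have : IsFiniteMeasure μ := ⟨htop.lt_top⟩
    calc 2 * b * ∫⁻ y, ENNReal.ofReal |f y| ∂μ
        ≤ 2 * b * (γ * L * μ univ) := by
          gcongr
          exact (lintegral_abs_le_sharpM_mul (N0 := N0) hUD hf (hf0 htop) x₀).trans
            (by gcongr; exact hx₀.2)
      _ = 2 * b * γ * (L * μ univ) := by ring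
      _ ≤ 1 * (L * μ univ) := by gcongr
      _ = L * μ univ := one_mul _
  have hE_union : E = ⋃ k : ℕ, E ∩ ball x₀ (6 ^ k) := by
    rw [← inter_iUnion, iUnion_ball_pow_six, inter_univ]
  have hE_mono : Monotone fun k : ℕ => E ∩ ball x₀ ((6 : ℝ) ^ k) :=
    fun _ _ h => inter_subset_inter_right _ (monotone_ball_pow_six x₀ h)
  rw [hE_union, hE_mono.measure_iUnion]
  refine iSup_le fun k => ?_
  obtain ⟨R, hR⟩ := exists_radius_bound hUD (one_le_betaCoef hUD.one_lt) hL hfin hsmall x₀ (6 ^ k)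
  have hball : ∀ x ∈ E ∩ ball x₀ (6 ^ k), ∃ (c : X) (s : ℝ), 0 < s ∧ s ≤ R ∧ x ∈ ball c s ∧
      IsDoublingBall μ 6 β c s ∧
      L * μ (ball c s) < ∫⁻ y in ball c s, ENNReal.ofReal |f y| ∂μ ∧
      ∀ (c' : X) (r' : ℝ), s / 108 ≤ r' → x ∈ ball c' r' → IsDoublingBall μ 6 β c' r' →
        ∫⁻ y in ball c' r', ENNReal.ofReal |f y| ∂μ ≤ 2 * L * μ (ball c' r') := fun x hx =>
    exists_stopping_ball hUD hA hL hγA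
      ((mul_le_mul_left (by norm_num : (2 : ℝ≥0∞) ≤ 3) L).trans_lt hx.1.1) hx.1.2 (hR x hx.2)
  choose! c s hs hsR hmem hd hbig hmax using hball
  obtain ⟨u, huE, hdisj, hcov⟩ := Vitali.exists_disjoint_subfamily_covering_enlargement
    (fun y => ball (c y) (s y)) (E ∩ ball x₀ (6 ^ k)) s 2 one_lt_two
    (fun y hy => (hs y hy).le) R hsR fun y hy => ⟨y, hmem y hy⟩
  have hcount : u.Countable := hdisj.countable_of_isOpen (fun _ _ => isOpen_ball)
    fun y hy => ⟨y, hmem y (huE hy)⟩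
  set F : X → Set X := fun v =>
    {y ∈ E ∩ ball x₀ (6 ^ k) | (ball (c y) (s y) ∩ ball (c v) (s v)).Nonempty ∧ s y ≤ 2 * s v}
  have hsub : E ∩ ball x₀ (6 ^ k) ⊆ ⋃ v ∈ u, F v := fun y hy => by
    obtain ⟨v, hv, h1, h2⟩ := hcov y hy
    exact mem_iUnion₂.2 ⟨v, hv, hy, h1, h2⟩
  have hFle : ∀ v ∈ u, μ (F v) ≤ N0 ^ 7 * (b ^ 2 * γ) * μ (ball (c v) (s v)) := by
    intro v hv
    have hsv := hs v (huE hv)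
    have hF5 : F v ⊆ ball (c v) (5 * s v) := by
      rintro y ⟨hy, ⟨w, hw1, hw2⟩, hle⟩
      have h1 := mem_ball.1 (hmem y hy)
      have h2 := mem_ball'.1 hw1
      have h3 := mem_ball.1 hw2
      rw [mem_ball]
      linarith [dist_triangle4 y (c y) w (c v)]
    obtain ⟨t, ht, htcov⟩ := hGD.exists_cover 7 (c v) (r := 5 * s v) (by positivity)
    have hpiece : ∀ z, μ (F v ∩ ball z (5 * s v / 2 ^ 7)) ≤
        b ^ 2 * γ * μ (ball (c v) (s v)) := fun z => by
      refine measure_local_le hUD hL hL0 hsv (hd v (huE hv)) (z := z) ?_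
        (inter_subset_left.trans hF5) (fun y hy => hy.1.1.1.1) (fun y hy => hy.1.1.1.2) ?_
      · exact inter_subset_right.trans (ball_subset_ball (by linarith))
      · rintro y ⟨⟨hy, -, hle⟩, -⟩ c' r' hr'
        exact hmax y hy c' r' (by linarith)
    calc μ (F v) ≤ μ (⋃ z ∈ t, F v ∩ ball z (5 * s v / 2 ^ 7)) := by
          refine measure_mono fun y hy => ?_
          obtain ⟨z, hz, hyz⟩ := mem_iUnion₂.1 (htcov (hF5 hy))
          exact mem_iUnion₂.2 ⟨z, hz, hy, hyz⟩
      _ ≤ ∑ z ∈ t, μ (F v ∩ ball z (5 * s v / 2 ^ 7)) := measure_biUnion_finset_le _ _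
      _ ≤ ∑ _ ∈ t, b ^ 2 * γ * μ (ball (c v) (s v)) := Finset.sum_le_sum fun z _ => hpiece z
      _ = t.card * (b ^ 2 * γ * μ (ball (c v) (s v))) := by
          rw [Finset.sum_const, nsmul_eq_mul]
      _ ≤ N0 ^ 7 * (b ^ 2 * γ * μ (ball (c v) (s v))) := by
          gcongr
          exact_mod_cast ht
      _ = _ := by ring
  calc μ (E ∩ ball x₀ (6 ^ k)) ≤ ∑' v : u, μ (F v) :=
        (measure_mono hsub).trans (measure_biUnion_le μ hcount _)
    _ ≤ ∑' v : u, N0 ^ 7 * (b ^ 2 * γ) * μ (ball (c v) (s v)) :=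
        ENNReal.tsum_le_tsum fun v => hFle v v.2
    _ = N0 ^ 7 * (b ^ 2 * γ) * μ (⋃ v ∈ u, ball (c v) (s v)) := by
        rw [ENNReal.tsum_mul_left, measure_biUnion hcount hdisj fun _ _ => measurableSet_ball]
    _ ≤ _ := by
        gcongr
        exact iUnion₂_subset fun v hv y hy =>
          lt_maxN_of_mem_ball hUD hL (hs v (huE hv)) hy (hd v (huE hv)) (hbig v (huE hv))

end Helpers

/-- **Lemma 3.1**: a good-λ type comparison between the doubling maximal operator `N`
and the sharp maximal operator `M♯`. -/
theorem maxN_le_sharpM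
    {X : Type*} [MetricSpace X] [MeasurableSpace X] [BorelSpace X]
    (μ : Measure X) (lam : X → ℝ → ℝ) (Clam : ℝ) (N0 : ℕ)
    (hUD : IsUpperDoubling μ lam Clam) (hGD : GeometricallyDoubling X N0)
    (p : ℝ) (hp : 1 ≤ p) :
    ∃ C : ℝ, 0 < C ∧ ∀ f : X → ℝ, LocallyIntegrable f μ →
      (μ Set.univ ≠ ⊤ → ∫ x, f x ∂μ = 0) →
      (∀ R : ℝ, 0 < R →
        (⨆ (ℓ : ℝ) (_ : ℓ ∈ Ioo (0 : ℝ) R), ENNReal.ofReal (ℓ ^ p) *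
          μ {x : X | ENNReal.ofReal ℓ < maxN μ (betaCoef Clam N0 6) f x}) < ⊤) →
      (⨆ (ℓ : ℝ) (_ : 0 < ℓ), ENNReal.ofReal (ℓ ^ p) *
          μ {x : X | ENNReal.ofReal ℓ < maxN μ (betaCoef Clam N0 6) f x}) ≤
        ENNReal.ofReal C *
          ⨆ (ℓ : ℝ) (_ : 0 < ℓ), ENNReal.ofReal (ℓ ^ p) *
            μ {x : X | ENNReal.ofReal ℓ < sharpM μ lam Clam N0 f x} := by
  obtain ⟨A, hA0, hA⟩ := exists_delta_le hUD N0 3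
  set β := betaCoef Clam N0 6
  have hβ : 1 ≤ β := one_le_betaCoef hUD.one_lt
  have h3p : (0 : ℝ) < 3 ^ p := by positivity
  set K : ℝ := 2 * 3 ^ p * (N0 ^ 7 * β ^ 2) + 2 * β + (1 + A) with hK
  have hN : 0 ≤ 2 * 3 ^ p * ((N0 : ℝ) ^ 7 * β ^ 2) := by positivity
  have hK0 : 0 < K := by linarith
  set γ : ℝ := K⁻¹ with hγdef
  have hγ : 0 < γ := inv_pos.2 hK0
  have hKle : ∀ a : ℝ, a ≤ K → a * γ ≤ 1 := fun a ha => by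
    rw [hγdef, ← div_eq_mul_inv]
    exact div_le_one_of_le₀ ha hK0.le
  have hγβ : 2 * ENNReal.ofReal β * ENNReal.ofReal γ ≤ 1 := by
    rw [← ENNReal.ofReal_ofNat 2, ← ENNReal.ofReal_mul (by norm_num),
      ← ENNReal.ofReal_mul (by positivity), ENNReal.ofReal_le_one]
    exact hKle _ (by linarith)
  have hγA : (ENNReal.ofReal β + ENNReal.ofReal (1 + A)) * ENNReal.ofReal γ ≤ 1 := by
    rw [← ENNReal.ofReal_add (by positivity) (by positivity),
      ← ENNReal.ofReal_mul (by positivity), ENNReal.ofReal_le_one]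
    exact hKle _ (by linarith)
  have hγN : ENNReal.ofReal (3 ^ p) * (N0 ^ 7 * (ENNReal.ofReal β ^ 2 * ENNReal.ofReal γ)) ≤
      2⁻¹ := by
    rw [← ENNReal.ofReal_natCast N0, ← ENNReal.ofReal_pow (by positivity),
      ← ENNReal.ofReal_pow (by positivity), ← ENNReal.ofReal_mul (by positivity),
      ← ENNReal.ofReal_mul (by positivity), ← ENNReal.ofReal_mul (by positivity),
      ← ENNReal.ofReal_ofNat 2, ← ENNReal.ofReal_inv_of_pos two_pos]
    refine ENNReal.ofReal_le_ofReal ?_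
    have := hKle (2 * 3 ^ p * (N0 ^ 7 * β ^ 2)) (by linarith)
    linarith
  refine ⟨2 * (3 / γ) ^ p, by positivity, fun f hf hf0 hfin => ?_⟩
  set G : ℝ≥0∞ := ⨆ (ℓ : ℝ) (_ : 0 < ℓ), ENNReal.ofReal (ℓ ^ p) *
    μ {x : X | ENNReal.ofReal ℓ < sharpM μ lam Clam N0 f x}
  refine iSup₂_le fun ℓ₀ hℓ₀ => ?_
  have hR := hfin (ℓ₀ + 1) (by linarith)
  set S : ℝ≥0∞ := ⨆ (ℓ : ℝ) (_ : ℓ ∈ Ioo (0 : ℝ) (ℓ₀ + 1)), ENNReal.ofReal (ℓ ^ p) *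
    μ {x : X | ENNReal.ofReal ℓ < maxN μ β f x}
  have hle_S : ∀ ℓ ∈ Ioo (0 : ℝ) (ℓ₀ + 1), ENNReal.ofReal (ℓ ^ p) *
      μ {x : X | ENNReal.ofReal ℓ < maxN μ β f x} ≤ S := fun ℓ hℓ =>
    le_iSup₂_of_le ℓ hℓ le_rfl
  have hstep : S ≤ 2⁻¹ * S + ENNReal.ofReal ((3 / γ) ^ p) * G := by
    refine iSup₂_le fun ℓ hℓ => ?_
    have hℓ0 : 0 < ℓ := hℓ.1
    have hthird := hle_S (ℓ / 3) ⟨by positivity, by linarith [hℓ.2]⟩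
    have hpow : 0 < (ℓ / 3) ^ p := by positivity
    have hΩ : μ {x : X | ENNReal.ofReal (ℓ / 3) < maxN μ β f x} < ∞ :=
      ENNReal.lt_top_of_mul_ne_top_right (hthird.trans_lt hR).ne (by simpa using hpow)
    have hgood := measure_good_lambda_le hUD hGD hA (L := ENNReal.ofReal (ℓ / 3))
      (γ := ENNReal.ofReal γ) ENNReal.ofReal_ne_top (by simpa using by positivity) hγβ hγA hf hf0 hΩ
    have h3 : 3 * ENNReal.ofReal (ℓ / 3) = ENNReal.ofReal ℓ := by
      rw [← ENNReal.ofReal_ofNat 3, ← ENNReal.ofReal_mul (by norm_num)]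
      congr 1
      ring
    rw [h3, ← ENNReal.ofReal_mul hγ.le] at hgood
    have hG_le : ENNReal.ofReal ((γ * (ℓ / 3)) ^ p) *
        μ {x : X | ENNReal.ofReal (γ * (ℓ / 3)) < sharpM μ lam Clam N0 f x} ≤ G :=
      le_iSup₂_of_le (γ * (ℓ / 3)) (by positivity) le_rfl
    have hsplit : {x : X | ENNReal.ofReal ℓ < maxN μ β f x} ⊆
        {x | ENNReal.ofReal ℓ < maxN μ β f x ∧
          sharpM μ lam Clam N0 f x ≤ ENNReal.ofReal (γ * (ℓ / 3))} ∪
        {x | ENNReal.ofReal (γ * (ℓ / 3)) < sharpM μ lam Clam N0 f x} := fun x hx =>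
      (le_or_gt (sharpM μ lam Clam N0 f x) (ENNReal.ofReal (γ * (ℓ / 3)))).imp
        (fun h => ⟨hx, h⟩) id
    have hpow3 : ENNReal.ofReal (ℓ ^ p) = ENNReal.ofReal (3 ^ p) * ENNReal.ofReal ((ℓ / 3) ^ p) := by
      rw [← ENNReal.ofReal_mul (by positivity), ← Real.mul_rpow (by norm_num) (by positivity)]
      congr 2
      ring
    have hpowγ : ENNReal.ofReal (ℓ ^ p) =
        ENNReal.ofReal ((3 / γ) ^ p) * ENNReal.ofReal ((γ * (ℓ / 3)) ^ p) := by
      rw [← ENNReal.ofReal_mul (by positivity), ← Real.mul_rpow (by positivity) (by positivity)]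
      congr 2
      field_simp
    calc ENNReal.ofReal (ℓ ^ p) * μ {x : X | ENNReal.ofReal ℓ < maxN μ β f x}
        ≤ ENNReal.ofReal (ℓ ^ p) * (N0 ^ 7 * (ENNReal.ofReal β ^ 2 * ENNReal.ofReal γ) *
            μ {x : X | ENNReal.ofReal (ℓ / 3) < maxN μ β f x} +
            μ {x | ENNReal.ofReal (γ * (ℓ / 3)) < sharpM μ lam Clam N0 f x}) := by
          gcongr
          exact (measure_mono hsplit).trans ((measure_union_le _ _).trans (by gcongr))
      _ = ENNReal.ofReal (3 ^ p) * (N0 ^ 7 * (ENNReal.ofReal β ^ 2 * ENNReal.ofReal γ)) *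
            (ENNReal.ofReal ((ℓ / 3) ^ p) *
              μ {x : X | ENNReal.ofReal (ℓ / 3) < maxN μ β f x}) +
          ENNReal.ofReal ((3 / γ) ^ p) * (ENNReal.ofReal ((γ * (ℓ / 3)) ^ p) *
            μ {x | ENNReal.ofReal (γ * (ℓ / 3)) < sharpM μ lam Clam N0 f x}) := by
          rw [mul_add]
          congr 1
          · rw [hpow3]
            ring
          · rw [hpowγ]
            ring
      _ ≤ 2⁻¹ * S + ENNReal.ofReal ((3 / γ) ^ p) * G := by gcongr
  have hhalf : 2⁻¹ * S ≤ ENNReal.ofReal ((3 / γ) ^ p) * G := by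
    have hS2 : 2⁻¹ * S + 2⁻¹ * S = S := by
      rw [← add_mul, ENNReal.inv_two_add_inv_two, one_mul]
    refine (ENNReal.add_le_add_iff_left (a := 2⁻¹ * S) (by finiteness)).1 ?_
    rwa [hS2]
  calc ENNReal.ofReal (ℓ₀ ^ p) * μ {x : X | ENNReal.ofReal ℓ₀ < maxN μ β f x}
      ≤ S := hle_S ℓ₀ ⟨hℓ₀, by linarith⟩
    _ = 2 * (2⁻¹ * S) := by
        rw [← mul_assoc, ENNReal.mul_inv_cancel two_ne_zero ENNReal.ofNat_ne_top, one_mul]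
    _ ≤ 2 * (ENNReal.ofReal ((3 / γ) ^ p) * G) := by gcongr
    _ = ENNReal.ofReal (2 * (3 / γ) ^ p) * G := by
        rw [ENNReal.ofReal_mul two_pos.le, ENNReal.ofReal_ofNat, mul_assoc]

end NonHomog
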